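/- arXiv:1711.01688 — 2 statements merged into one kernel-verified Lean document; each statement's English description precedes it below -/
import Mathlib

section
/- Let p be a prime, G a finite group, and g ∈ G a p-element (an element whose order is a power of p). Then g lies in the absolute hypercenter L_∞(G) if and only if α(g) = g for every automorphism α ∈ Aut G whose order is coprime to p. -/
/-- The autocommutator `[x, α] = x⁻¹ · α(x)`. -/
def autoComm {G : Type*} [Group G] (x : G) (α : MulAut G) : G := x⁻¹ * α x

/-- `autoL G n = Lₙ(G)`: elements `x` with `[x, α₁, …, αₙ] = 1` for all `α₁, …, αₙ ∈ Aut G`. -/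
def autoL (G : Type*) [Group G] (n : ℕ) : Set G :=
  {x | ∀ l : List (MulAut G), l.length = n → l.foldl autoComm x = 1}

section Order

open Subgroup

variable {G : Type*} [Group G] {p : ℕ}

theorem exists_coprime_orderOf_pow_prime_pow [Finite G] (hp : p.Prime) (x : G) :
    ∃ k, (orderOf (x ^ p ^ k)).Coprime p := by
  obtain ⟨k, m, hm, h⟩ := Nat.exists_eq_pow_mul_and_not_dvd (orderOf_pos x).ne' p hp.ne_one
  refine ⟨k, ?_⟩
  rw [orderOf_pow_of_dvd (pow_pos hp.pos k).ne' (h ▸ dvd_mul_right _ _), h,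
    Nat.mul_div_cancel_left _ (pow_pos hp.pos k)]
  exact ((hp.coprime_iff_not_dvd).2 hm).symm

theorem eq_one_of_pow_prime_pow_of_pow_coprime {x : G} {k m : ℕ} (hk : x ^ p ^ k = 1)
    (hm : x ^ m = 1) (h : m.Coprime p) : x = 1 := by
  rw [← orderOf_eq_one_iff]
  exact Nat.eq_one_of_dvd_coprimes (h.pow_right k) (orderOf_dvd_of_pow_eq_one hm)
    (orderOf_dvd_of_pow_eq_one hk)

/-- In a finite nilpotent group, the `p`-elements are closed under multiplication. -/
theorem Group.IsNilpotent.exists_mul_pow_prime_pow_eq_one [Finite G] [Group.IsNilpotent G]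
    (hp : p.Prime) {x y : G} (hx : ∃ k, x ^ p ^ k = 1) (hy : ∃ k, y ^ p ^ k = 1) :
    ∃ k, (x * y) ^ p ^ k = 1 := by
  have : Fact p.Prime := ⟨hp⟩
  obtain ⟨P⟩ : Nonempty (Sylow p G) := inferInstance
  have mem : ∀ {z : G}, (∃ k, z ^ p ^ k = 1) → z ∈ (P : Subgroup G) := by
    rintro z ⟨k, hk⟩
    have hz : IsPGroup p (zpowers z) :=
      IsPGroup.of_card_dvd_pow (n := k) (Nat.card_zpowers z ▸ orderOf_dvd_of_pow_eq_one hk)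
    obtain ⟨Q, hQ⟩ := hz.exists_le_sylow
    have := Sylow.unique_of_normal P inferInstance
    exact Subsingleton.elim Q P ▸ hQ (mem_zpowers z)
  obtain ⟨k, hk⟩ := isPGroup_iff_pow_pow_eq_one.1 P.isPGroup' ⟨x * y, mul_mem (mem hx) (mem hy)⟩
  exact ⟨k, congrArg Subtype.val hk⟩

end Order

section AutoL

open Subgroup

variable {G : Type*} [Group G]

theorem mem_autoL_zero {x : G} : x ∈ autoL G 0 ↔ x = 1 := by
  simp [autoL]

theorem mem_autoL_succ {n : ℕ} {x : G} :
    x ∈ autoL G (n + 1) ↔ ∀ α : MulAut G, autoComm x α ∈ autoL G n := by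
  refine ⟨fun h α l hl => h (α :: l) (by simp [hl]), fun h l hl => ?_⟩
  match l, hl with
  | α :: l, hl => exact h α l (by simpa using hl)

theorem map_autoComm (x : G) (α β : MulAut G) :
    β (autoComm x α) = autoComm (β x) (β * α * β⁻¹) := by
  simp [autoComm]

theorem autoComm_mul (x y : G) (α : MulAut G) :
    autoComm (x * y) α = MulAut.conj y⁻¹ (autoComm x α) * autoComm y α := by
  simp [autoComm, mul_assoc]

theorem autoComm_inv (x : G) (α : MulAut G) :
    autoComm x⁻¹ α = MulAut.conj x (autoComm x α)⁻¹ := by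
  simp [autoComm, mul_assoc]

theorem map_mem_autoL {n : ℕ} {x : G} (β : MulAut G) (hx : x ∈ autoL G n) :
    β x ∈ autoL G n := by
  induction n generalizing x with
  | zero => simpa [mem_autoL_zero] using hx
  | succ n ih =>
    rw [mem_autoL_succ] at hx ⊢
    intro α
    have h := map_autoComm x (β⁻¹ * α * β) β
    simp only [mul_assoc, mul_inv_cancel_left, mul_inv_cancel, mul_one] at h
    exact h ▸ ih (hx _)

/-- The set `Lₙ(G)` as a subgroup. -/
def autoLSubgroup (G : Type*) [Group G] (n : ℕ) : Subgroup G where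
  carrier := autoL G n
  one_mem' := by
    induction n with
    | zero => simp [mem_autoL_zero]
    | succ n ih => simpa [mem_autoL_succ, autoComm] using ih
  mul_mem' := by
    induction n with
    | zero => simp +contextual [mem_autoL_zero]
    | succ n ih =>
      intro x y hx hy
      rw [mem_autoL_succ] at hx hy ⊢
      intro α
      rw [autoComm_mul]
      exact ih (map_mem_autoL _ (hx α)) (hy α)
  inv_mem' := by
    induction n with
    | zero => simp [mem_autoL_zero]
    | succ n ih =>
      intro x hx
      rw [mem_autoL_succ] at hx ⊢
      intro α
      rw [autoComm_inv]
      exact map_mem_autoL _ (ih (hx α))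

theorem mem_autoLSubgroup {n : ℕ} {x : G} : x ∈ autoLSubgroup G n ↔ x ∈ autoL G n := Iff.rfl

instance isNilpotent_autoLSubgroup (n : ℕ) : Group.IsNilpotent (autoLSubgroup G n) := by
  refine (Subgroup.nilpotent_iff_finite_ascending_central_series _).2
    ⟨n, fun i => (autoLSubgroup G i).subgroupOf (autoLSubgroup G n), ⟨?_, ?_⟩, by simp⟩
  · ext x
    simp [mem_subgroupOf, mem_autoLSubgroup, mem_autoL_zero]
  · intro x i hx y
    rw [mem_subgroupOf] at hx ⊢
    have h := mem_autoL_succ.1 ((autoLSubgroup G (i + 1)).inv_mem hx) (MulAut.conj (y : G))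
    simpa [mem_autoLSubgroup, autoComm, commutatorElement_def, mul_assoc] using h

/-- Automorphisms of order prime to `p` fix the `p`-elements of `Lₙ(G)`. -/
theorem apply_eq_self_of_mem_autoL [Finite G] {p n : ℕ} (hp : p.Prime) {x : G}
    (hx : ∃ k, x ^ p ^ k = 1) (hxn : x ∈ autoL G n) {α : MulAut G}
    (hα : (orderOf α).Coprime p) : α x = x := by
  induction n generalizing x with
  | zero => simp [mem_autoL_zero.1 hxn]
  | succ n ih =>
    have hc : ∃ k, (autoComm x α) ^ p ^ k = 1 := by
      obtain ⟨k, hk⟩ := hx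
      obtain ⟨j, hj⟩ := Group.IsNilpotent.exists_mul_pow_prime_pow_eq_one hp
        (x := (⟨x⁻¹, (autoLSubgroup G (n + 1)).inv_mem hxn⟩ : autoLSubgroup G (n + 1)))
        (y := ⟨α x, map_mem_autoL α hxn⟩)
        ⟨k, Subtype.ext (by simp [hk])⟩ ⟨k, Subtype.ext (by simp [← map_pow, hk])⟩
      exact ⟨j, congrArg Subtype.val hj⟩
    have hfix := ih hc (mem_autoL_succ.1 hxn α)
    have hpow : ∀ m : ℕ, (α ^ m) x = x * autoComm x α ^ m := by
      intro m
      induction m with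
      | zero => simp
      | succ m ihm =>
        rw [pow_succ', MulAut.mul_apply, ihm, map_mul, map_pow, hfix, pow_succ']
        simp [autoComm, mul_assoc]
    have hm : autoComm x α ^ orderOf α = 1 := by simpa [pow_orderOf_eq_one] using hpow (orderOf α)
    obtain ⟨k, hk⟩ := hc
    exact (inv_mul_eq_one.1 (eq_one_of_pow_prime_pow_of_pow_coprime hk hm hα)).symm

end AutoL

section CoprimeFixed

open Subgroup

variable {G : Type*} [Group G] {p : ℕ}

/-- The subgroup of elements fixed by all automorphisms of order prime to `p`. -/
def coprimeFixed (G : Type*) [Group G] (p : ℕ) : Subgroup G where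
  carrier := {x | ∀ α : MulAut G, (orderOf α).Coprime p → α x = x}
  one_mem' := by simp
  mul_mem' hx hy α hα := by rw [map_mul, hx α hα, hy α hα]
  inv_mem' hx α hα := by rw [map_inv, hx α hα]

theorem map_mem_coprimeFixed {x : G} (β : MulAut G) (hx : x ∈ coprimeFixed G p) :
    β x ∈ coprimeFixed G p := by
  intro α hα
  have h : orderOf (β⁻¹ * α * β) = orderOf α := by
    simpa using orderOf_injective (MulAut.conj β⁻¹).toMonoidHom (MulAut.conj β⁻¹).injective α
  simpa using congrArg β (hx (β⁻¹ * α * β) (h ▸ hα))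

theorem isNilpotent_coprimeFixed [Finite G] (hp : p.Prime) :
    Group.IsNilpotent (coprimeFixed G p) := by
  have : Fact p.Prime := ⟨hp⟩
  refine Group.of_quotient_center_nilpotent (IsPGroup.isNilpotent (p := p) ?_)
  refine isPGroup_iff_pow_pow_eq_one.2 fun q => ?_
  obtain ⟨y, rfl⟩ := QuotientGroup.mk_surjective q
  obtain ⟨k, hk⟩ := exists_coprime_orderOf_pow_prime_pow hp (y : G)
  refine ⟨k, ?_⟩
  rw [← QuotientGroup.mk_pow, QuotientGroup.eq_one_iff, mem_center_iff]
  intro x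
  have h := x.2 (MulAut.conj ((y : G) ^ p ^ k))
    (hk.coprime_dvd_left (orderOf_map_dvd MulAut.conj _))
  rw [MulAut.conj_apply, mul_inv_eq_iff_eq_mul] at h
  exact Subtype.ext h.symm

/-- The subgroup of `p`-elements fixed by all automorphisms of order prime to `p`. -/
def coprimeFixedPrimary (G : Type*) [Group G] [Finite G] (hp : p.Prime) : Subgroup G where
  carrier := {x | x ∈ coprimeFixed G p ∧ ∃ k, x ^ p ^ k = 1}
  one_mem' := ⟨one_mem _, 0, one_pow _⟩
  mul_mem' {x y} hx hy := by
    have := isNilpotent_coprimeFixed (G := G) hp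
    obtain ⟨hx, k, hk⟩ := hx
    obtain ⟨hy, l, hl⟩ := hy
    obtain ⟨j, hj⟩ := Group.IsNilpotent.exists_mul_pow_prime_pow_eq_one hp
      (x := (⟨x, hx⟩ : coprimeFixed G p)) (y := ⟨y, hy⟩)
      ⟨k, Subtype.ext hk⟩ ⟨l, Subtype.ext hl⟩
    exact ⟨mul_mem hx hy, j, congrArg Subtype.val hj⟩
  inv_mem' hx := ⟨inv_mem hx.1, hx.2.imp fun k hk => by rw [inv_pow, hk, inv_one]⟩

instance characteristic_coprimeFixedPrimary [Finite G] (hp : p.Prime) :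
    (coprimeFixedPrimary G hp).Characteristic :=
  characteristic_iff_le_comap.2 fun β _ hx =>
    ⟨map_mem_coprimeFixed β hx.1, hx.2.imp fun k hk => by
      change β _ ^ p ^ k = 1
      rw [← map_pow, hk, map_one]⟩

theorem isPGroup_coprimeFixedPrimary [Finite G] (hp : p.Prime) :
    IsPGroup p (coprimeFixedPrimary G hp) :=
  isPGroup_iff_pow_pow_eq_one.2 fun x => x.2.2.imp fun _ hk => Subtype.ext hk

theorem isPGroup_range_characteristic_coprimeFixedPrimary [Finite G] (hp : p.Prime) :
    IsPGroup p (MulAut.characteristic (coprimeFixedPrimary G hp)).range := by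
  refine isPGroup_iff_pow_pow_eq_one.2 ?_
  rintro ⟨φ, hφ⟩
  obtain ⟨α, rfl⟩ := hφ
  obtain ⟨k, hk⟩ := exists_coprime_orderOf_pow_prime_pow hp α
  refine ⟨k, Subtype.ext ?_⟩
  rw [coe_pow, ← map_pow]
  ext x
  exact x.2.1 _ hk

end CoprimeFixed

open SemidirectProduct in
theorem coe_mem_autoL_of_inl_mem_upperCentralSeries {G : Type*} [Group G] {P : Subgroup G}
    [P.Characteristic] {n : ℕ} {x : P}
    (hx : (inl x : P ⋊[(MulAut.characteristic P).range.subtype] (MulAut.characteristic P).range) ∈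
      Subgroup.upperCentralSeries _ n) : (x : G) ∈ autoL G n := by
  induction n generalizing x with
  | zero =>
    rw [Subgroup.upperCentralSeries_zero, Subgroup.mem_bot, ← map_one inl, inl_inj] at hx
    simp [mem_autoL_zero, hx]
  | succ n ih =>
    refine mem_autoL_succ.2 fun α => ?_
    have h := (Subgroup.upperCentralSeries_isAscendingCentralSeries _).2 _ n (inv_mem hx)
      (inr ⟨MulAut.characteristic P α, α, rfl⟩)
    refine ih (x := x⁻¹ * MulAut.characteristic P α x) ?_
    rw [map_mul]
    convert h using 1
    rw [commutatorElement_def, inv_inv, mul_assoc, mul_assoc, ← map_inv inr, ← mul_assoc (inr _),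
      ← inl_aut, map_inv]
    rfl

/-- A `p`-element `g` of a finite group `G` lies in the absolute hypercenter
`L_∞(G) = ⋃ₙ Lₙ(G)` iff `α(g) = g` for every automorphism `α` of order coprime to `p`. -/
theorem mem_absoluteHypercenter_iff (p : ℕ) (hp : p.Prime) (G : Type*) [Group G] [Finite G]
    (g : G) (hg : ∃ k : ℕ, orderOf g = p ^ k) :
    (∃ n : ℕ, g ∈ autoL G n) ↔
      ∀ α : MulAut G, Nat.Coprime (orderOf α) p → α g = g := by
  have hg' : ∃ k, g ^ p ^ k = 1 := by
    obtain ⟨k, hk⟩ := hg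
    exact ⟨k, hk ▸ pow_orderOf_eq_one g⟩
  refine ⟨fun ⟨n, hn⟩ α hα => apply_eq_self_of_mem_autoL hp hg' hn hα, fun h => ?_⟩
  have : Fact p.Prime := ⟨hp⟩
  let P := coprimeFixedPrimary G hp
  let A := (MulAut.characteristic P).range
  have : Finite (P ⋊[A.subtype] A) := Finite.of_equiv _ SemidirectProduct.equivProd.symm
  have hQ : IsPGroup p (P ⋊[A.subtype] A) := by
    obtain ⟨a, ha⟩ := IsPGroup.iff_card.1 (isPGroup_coprimeFixedPrimary (G := G) hp)
    obtain ⟨b, hb⟩ := IsPGroup.iff_card.1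
      (isPGroup_range_characteristic_coprimeFixedPrimary (G := G) hp)
    exact IsPGroup.of_card (n := a + b) (by rw [SemidirectProduct.card, ha, hb, pow_add])
  obtain ⟨n, hn⟩ := hQ.isNilpotent.nilpotent
  exact ⟨n, coe_mem_autoL_of_inl_mem_upperCentralSeries (x := (⟨g, h, hg'⟩ : P))
    (hn ▸ Subgroup.mem_top _)⟩
end

section
/- Let p be a prime and G a finite group. A p-element g of G belongs to the hypercenter Z_∞(G) if and only if g commutes with every element of G whose order is coprime to p. -/
open Subgroup commutatorElement in
/-- Two elements of finite coprime orders whose commutator is central commute. -/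
theorem commute_of_commutatorElement_mem_center {G : Type*} [Group G] {a b : G} {m n : ℕ}
    (hmn : Nat.Coprime m n) (ha : a ^ m = 1) (hb : b ^ n = 1) (hc : ⁅a, b⁆ ∈ center G) :
    Commute a b := by
  have hcen : ∀ y, Commute ⁅a, b⁆ y := fun y => (mem_center_iff.mp hc y).symm
  have h₁ : a * b * a⁻¹ = ⁅a, b⁆ * b := by simp [commutatorElement_def]
  have h₂ : b * a * b⁻¹ = ⁅a, b⁆⁻¹ * a := by simp [commutatorElement_def, mul_assoc]
  have hn : ⁅a, b⁆ ^ n = 1 := by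
    have h := congrArg (· ^ n) h₁
    simpa [conj_pow, (hcen b).mul_pow, hb] using h.symm
  have hm : ⁅a, b⁆ ^ m = 1 := by
    have h := congrArg (· ^ m) h₂
    simp only [conj_pow, (hcen a).inv_left.mul_pow, ha, mul_one, mul_inv_cancel, inv_pow] at h
    exact inv_eq_one.mp h.symm
  rw [← commutatorElement_eq_one_iff_commute, ← orderOf_eq_one_iff]
  exact Nat.eq_one_of_dvd_coprimes hmn (orderOf_dvd_of_pow_eq_one hm)
    (orderOf_dvd_of_pow_eq_one hn)

open Subgroup commutatorElement in
/-- An element of the upper central series commutes with every element of coprime order. -/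
theorem commute_of_mem_upperCentralSeries {G : Type*} [Group G] {a b : G} {n : ℕ}
    (ha : a ∈ Subgroup.upperCentralSeries G n) (hab : Nat.Coprime (orderOf a) (orderOf b)) :
    Commute a b := by
  have key : ∀ k, ⁅a, b⁆ ∈ Subgroup.upperCentralSeries G k → ⁅a, b⁆ = 1 := by
    intro k
    induction k with
    | zero => simp
    | succ k ih =>
      intro h
      apply ih
      have h' : ⁅a, b⁆ ∈ Subgroup.upperCentralSeriesStep (Subgroup.upperCentralSeries G k) := h
      rw [Subgroup.upperCentralSeriesStep_eq_comap_center, mem_comap, map_commutatorElement] at h'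
      have hcomm := commute_of_commutatorElement_mem_center hab
        (by rw [← map_pow, pow_orderOf_eq_one, map_one])
        (by rw [← map_pow, pow_orderOf_eq_one, map_one]) h'
      rwa [← commutatorElement_eq_one_iff_commute, ← map_commutatorElement,
        QuotientGroup.mk'_apply, QuotientGroup.eq_one_iff] at hcomm
  have ha' : a ∈ Subgroup.upperCentralSeries G (n + 1) := Subgroup.upperCentralSeries_mono G n.le_succ ha
  exact commutatorElement_eq_one_iff_commute.mp
    (key n (Subgroup.mem_upperCentralSeries_succ_iff.mp ha' b))

open Subgroup commutatorElement in
/-- If `G = S * H`, elements of the upper central series of `S` centralizing the normal subgroup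
`H` lie in the upper central series of `G`. -/
theorem coe_mem_upperCentralSeries_of_mem_centralizer {G : Type*} [Group G] {S H : Subgroup G}
    [H.Normal] (hSH : S ⊔ H = ⊤) (n : ℕ) {x : S} (hx : x ∈ Subgroup.upperCentralSeries S n)
    (hxH : (x : G) ∈ centralizer (H : Set G)) : (x : G) ∈ Subgroup.upperCentralSeries G n := by
  induction n generalizing x with
  | zero => simpa using hx
  | succ n ih =>
    rw [Subgroup.mem_upperCentralSeries_succ_iff]
    intro y
    obtain ⟨s, hs, h, hh, rfl⟩ := mem_sup_of_normal_right.mp (hSH ▸ mem_top y : y ∈ S ⊔ H)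
    have hxh : h * x = x * h := mem_centralizer_iff.mp hxH h hh
    have hcomm : ⁅(x : G), s * h⁆ = ((⁅x, ⟨s, hs⟩⁆ : S) : G) := by
      have hconj : h * (x : G)⁻¹ * h⁻¹ = (x : G)⁻¹ := by
        have hc : Commute h (x : G) := hxh
        rw [hc.inv_right.eq, mul_inv_cancel_right]
      calc ⁅(x : G), s * h⁆ = x * s * (h * (x : G)⁻¹ * h⁻¹) * s⁻¹ := by
            simp [commutatorElement_def, mul_assoc]
        _ = _ := by rw [hconj]; simp [commutatorElement_def]
    rw [hcomm]
    refine ih (Subgroup.mem_upperCentralSeries_succ_iff.mp hx _) ?_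
    rw [← hcomm, commutatorElement_def, mul_assoc, mul_assoc, ← mul_assoc (s * h)]
    exact mul_mem hxH
      ((inferInstance : (centralizer (H : Set G)).Normal).conj_mem _ (inv_mem hxH) _)

open Subgroup commutatorElement in
/-- A Sylow `p`-subgroup together with a normal subgroup containing all elements of order coprime
to `p` generates the group. -/
theorem Sylow.sup_eq_top_of_coprime_orderOf_mem {G : Type*} [Group G] [Finite G] {p : ℕ}
    [Fact p.Prime] (S : Sylow p G) {H : Subgroup G} [H.Normal]
    (hH : ∀ x : G, Nat.Coprime (orderOf x) p → x ∈ H) : (S : Subgroup G) ⊔ H = ⊤ := by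
  have hp : p.Prime := Fact.out
  have hQ : IsPGroup p (G ⧸ H) := by
    intro q
    obtain ⟨y, rfl⟩ := QuotientGroup.mk_surjective q
    refine ⟨(orderOf y).factorization p, ?_⟩
    rw [← QuotientGroup.mk_pow, QuotientGroup.eq_one_iff]
    apply hH
    rw [orderOf_pow_of_dvd (pow_ne_zero _ hp.ne_zero) (Nat.ordProj_dvd _ _)]
    exact (Nat.coprime_ordCompl hp (orderOf_pos y).ne').symm
  obtain ⟨k, hk⟩ := IsPGroup.iff_card.mp hQ
  have h₁ : ((S : Subgroup G) ⊔ H).index ∣ p ^ k := by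
    rw [← hk]
    exact index_dvd_of_le le_sup_right
  have h₂ : ((S : Subgroup G) ⊔ H).index ∣ (S : Subgroup G).index :=
    index_dvd_of_le le_sup_left
  rw [← index_eq_one]
  exact Nat.eq_one_of_dvd_coprimes
    (Nat.Coprime.pow_left k ((Nat.Prime.coprime_iff_not_dvd hp).mpr S.not_dvd_index)) h₁ h₂

/-- (Baer) A `p`-element `g` of a finite group `G` belongs to the hypercenter `Z_∞(G)` (the
stable term of the upper central series) iff `g` commutes with every element of `G` whose
order is coprime to `p`. -/
theorem pElement_mem_hypercenter_iff (p : ℕ) (hp : p.Prime) (G : Type*) [Group G] [Finite G]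
    (g : G) (hg : ∃ k : ℕ, orderOf g = p ^ k) :
    g ∈ ⨆ n : ℕ, upperCentralSeries G n ↔
      ∀ x : G, Nat.Coprime (orderOf x) p → Commute g x := by
  have : Fact p.Prime := ⟨hp⟩
  obtain ⟨k, hk⟩ := hg
  constructor
  · intro h x hx
    obtain ⟨n, hn⟩ := (Subgroup.mem_iSup_of_directed
      (Subgroup.upperCentralSeries_mono G).directed_le).mp h
    exact commute_of_mem_upperCentralSeries hn (hk ▸ hx.symm.pow_left k)
  · intro h
    let T : Set G := {x | Nat.Coprime (orderOf x) p}
    have hgp : IsPGroup p (Subgroup.zpowers g) :=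
      IsPGroup.of_card (n := k) (by rw [Nat.card_zpowers, hk])
    obtain ⟨S, hS⟩ := hgp.exists_le_sylow
    obtain ⟨n, hn⟩ := (S.isPGroup'.isNilpotent).nilpotent
    have hgC : g ∈ Subgroup.centralizer (Subgroup.normalClosure T : Set G) := by
      rw [Subgroup.normalClosure, Subgroup.centralizer_closure, Subgroup.mem_centralizer_iff]
      intro x hx
      obtain ⟨y, hy, hyx⟩ := Group.mem_conjugatesOfSet_iff.mp hx
      obtain ⟨c, rfl⟩ := isConj_iff.mp hyx
      have hc : orderOf (c * y * c⁻¹) = orderOf y := (MulAut.conj c).orderOf_eq y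
      exact (h _ (hc ▸ hy)).symm.eq
    exact Subgroup.mem_iSup_of_mem n (coe_mem_upperCentralSeries_of_mem_centralizer
      (S.sup_eq_top_of_coprime_orderOf_mem (H := Subgroup.normalClosure T)
        fun x hx => Subgroup.subset_normalClosure hx) n
      (x := ⟨g, hS (Subgroup.mem_zpowers g)⟩) (hn ▸ Subgroup.mem_top _) hgC)
end
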